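/- arXiv:2408.11725 — 3 statements merged into one kernel-verified Lean document; each statement's English description precedes it below -/
import Mathlib

section
/- Let P_1, …, P_N be Markov kernels on a measurable space (X, ℬ) and let π be a probability measure that is invariant for each P_i. Suppose the systematic-scan kernel P_GS = P_1 P_2 ⋯ P_N is uniformly ergodic with invariant distribution π. Then for every ε > 0 and every q ∈ [ε,1]^N, the multiple random-scan kernel P_q is uniformly ergodic with invariant distribution π. (Proposition 3.1: if the systematic scan Gibbs sampler is uniformly ergodic, so is MRSG(q).) -/
open MeasureTheory ProbabilityTheory Filter
open scoped ENNReal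

/-- Total variation distance between two measures:
`‖μ − ν‖_TV = sup_{A ∈ ℬ} |μ(A) − ν(A)|`. -/
noncomputable def tvDist {X : Type*} [MeasurableSpace X] (μ ν : Measure X) : ℝ :=
  ⨆ A : {s : Set X // MeasurableSet s}, |(μ A.1).toReal - (ν A.1).toReal|

/-- `n`-fold composition of a kernel with itself (`kpow P 0` is the identity kernel).
Recall `η ∘ₖ κ` applies `κ` first and then `η`. -/
noncomputable def kpow {X : Type*} [MeasurableSpace X] (P : Kernel X X) : ℕ → Kernel X X
  | 0 => Kernel.id
  | n + 1 => kpow P n ∘ₖ P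

/-- Composition of a list of kernels, applying them in the order of the list. -/
noncomputable def seqComp {X : Type*} [MeasurableSpace X] (l : List (Kernel X X)) : Kernel X X :=
  l.foldl (fun acc κ => κ ∘ₖ acc) Kernel.id

/-- The composed kernel `P_S` for a subset `S ⊆ {1,…,N}`, applying the kernels of `S` in
increasing index order. -/
noncomputable def subsetComp {X : Type*} [MeasurableSpace X] {N : ℕ}
    (P : Fin N → Kernel X X) (S : Finset (Fin N)) : Kernel X X :=
  seqComp ((S.sort (· ≤ ·)).map P)

/-- The systematic-scan (Gibbs) kernel `P_GS = P_1 P_2 ⋯ P_N`. -/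
noncomputable def gsKernel {X : Type*} [MeasurableSpace X] {N : ℕ}
    (P : Fin N → Kernel X X) : Kernel X X :=
  subsetComp P Finset.univ

/-- Selection weight `w_S(q)` of a nonempty subset `S` in the multiple random-scan scheme:
`w_S(q) = (∏_{i∈S} q_i ∏_{i∉S} (1 − q_i)) / (1 − ∏_i (1 − q_i))`. -/
noncomputable def selWeight {N : ℕ} (q : Fin N → ℝ) (S : Finset (Fin N)) : ℝ :=
  ((∏ i ∈ S, q i) * ∏ i ∈ Sᶜ, (1 - q i)) / (1 - ∏ i, (1 - q i))

/-- Scalar multiple of a kernel by an extended nonnegative real. -/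
noncomputable def kSMul {X : Type*} [MeasurableSpace X] (c : ℝ≥0∞) (κ : Kernel X X) :
    Kernel X X :=
  ⟨fun x => c • κ x, Measure.measurable_of_measurable_coe _ (fun s hs => by
    simp_rw [Measure.smul_apply, smul_eq_mul]
    exact (κ.measurable_coe hs).const_mul c)⟩

/-- The multiple random-scan kernel `P_q = Σ_{∅≠S⊆{1,…,N}} w_S(q) P_S`. -/
noncomputable def mrsKernel {X : Type*} [MeasurableSpace X] {N : ℕ}
    (P : Fin N → Kernel X X) (q : Fin N → ℝ) : Kernel X X :=
  ∑ S ∈ Finset.univ.filter (fun S : Finset (Fin N) => S.Nonempty),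
    kSMul (ENNReal.ofReal (selWeight q S)) (subsetComp P S)

/-- The single-coordinate random-scan kernel `P_p = Σ_{i=1}^N p_i P_i`. -/
noncomputable def rsKernel {X : Type*} [MeasurableSpace X] {N : ℕ}
    (P : Fin N → Kernel X X) (p : Fin N → ℝ) : Kernel X X :=
  ∑ i : Fin N, kSMul (ENNReal.ofReal (p i)) (P i)

/-- The Dobrushin contraction coefficient `β(P) = sup_{x,y} ‖P(x,·) − P(y,·)‖_TV`. -/
noncomputable def dobrushin {X : Type*} [MeasurableSpace X] (P : Kernel X X) : ℝ :=
  ⨆ x : X, ⨆ y : X, tvDist (P x) (P y)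

/-- A kernel `P` with target probability measure `π` is uniformly ergodic if
`sup_x ‖P^n(x,·) − π‖_TV ≤ M ρ^n` for some `M ≥ 0` and `ρ ∈ [0,1)` and all `n ≥ 1`. -/
def UniformlyErgodic {X : Type*} [MeasurableSpace X] (P : Kernel X X) (π : Measure X) : Prop :=
  ∃ M ρ : ℝ, 0 ≤ M ∧ 0 ≤ ρ ∧ ρ < 1 ∧
    ∀ n : ℕ, 1 ≤ n → ∀ x : X, tvDist (kpow P n x) π ≤ M * ρ ^ n

section TotalVariation

variable {X : Type*} [MeasurableSpace X]

lemma abs_measureReal_sub_le_one (μ ν : Measure X) [IsProbabilityMeasure μ]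
    [IsProbabilityMeasure ν] (A : Set X) : |μ.real A - ν.real A| ≤ 1 := by
  have h₁ : μ.real A ≤ 1 := measureReal_le_one
  have h₂ : ν.real A ≤ 1 := measureReal_le_one
  have h₃ : 0 ≤ μ.real A := measureReal_nonneg
  have h₄ : 0 ≤ ν.real A := measureReal_nonneg
  exact abs_sub_le_iff.2 ⟨by linarith, by linarith⟩

lemma abs_measureReal_sub_le_tvDist (μ ν : Measure X) [IsProbabilityMeasure μ]
    [IsProbabilityMeasure ν] {A : Set X} (hA : MeasurableSet A) :
    |μ.real A - ν.real A| ≤ tvDist μ ν := by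
  refine le_ciSup (f := fun A : {s : Set X // MeasurableSet s} =>
    |(μ A.1).toReal - (ν A.1).toReal|) ⟨1, ?_⟩ ⟨A, hA⟩
  rintro _ ⟨B, rfl⟩
  exact abs_measureReal_sub_le_one μ ν B

lemma tvDist_le {μ ν : Measure X} {t : ℝ}
    (h : ∀ A, MeasurableSet A → |μ.real A - ν.real A| ≤ t) : tvDist μ ν ≤ t :=
  have : Nonempty {s : Set X // MeasurableSet s} := ⟨⟨∅, .empty⟩⟩
  ciSup_le fun A => h A.1 A.2

lemma tvDist_le_one (μ ν : Measure X) [IsProbabilityMeasure μ] [IsProbabilityMeasure ν] :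
    tvDist μ ν ≤ 1 :=
  tvDist_le fun A _ => abs_measureReal_sub_le_one μ ν A

lemma integral_sub_le_of_measureReal_sub_le {μ ν : Measure X} [IsProbabilityMeasure μ]
    [IsProbabilityMeasure ν] {t d : ℝ} (hd : 0 ≤ d)
    (h : ∀ A, MeasurableSet A → μ.real A - ν.real A ≤ t)
    {f : X → ℝ} (hf : Measurable f) (hfd : ∀ x, |f x| ≤ d) :
    ∫ x, f x ∂μ - ∫ x, f x ∂ν ≤ t * (2 * d) := by
  have layer (m : Measure X) [IsProbabilityMeasure m] :
      Integrable f m ∧ ∫ x, f x ∂m + d = ∫ s in Set.Ioc 0 (2 * d), m.real {x | s ≤ f x + d} := by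
    have hi : Integrable f m := .of_bound hf.aestronglyMeasurable d (.of_forall hfd)
    refine ⟨hi, ?_⟩
    rw [← Integrable.integral_eq_integral_Ioc_meas_le (f := fun x => f x + d)
      (hi.add (integrable_const d)), integral_add hi (integrable_const d)]
    · simp
    · exact .of_forall fun x => by have := abs_le.1 (hfd x); simp; linarith
    · exact .of_forall fun x => by have := abs_le.1 (hfd x); simp; linarith
  have tail_integrable (m : Measure X) [IsProbabilityMeasure m] :
      IntegrableOn (fun s => m.real {x | s ≤ f x + d}) (Set.Ioc 0 (2 * d)) := by
    have anti : Antitone fun s => m.real {x | s ≤ f x + d} := fun a b hab =>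
      measureReal_mono fun x (hx : b ≤ f x + d) => hab.trans hx
    exact (anti.locallyIntegrable.integrableOn_isCompact isCompact_Icc).mono_set
      Set.Ioc_subset_Icc_self
  have key : ∫ s in Set.Ioc 0 (2 * d), (μ.real {x | s ≤ f x + d} - ν.real {x | s ≤ f x + d}) ≤
      ∫ s in Set.Ioc 0 (2 * d), t :=
    integral_mono ((tail_integrable μ).sub (tail_integrable ν)) (integrable_const t) fun s =>
      h _ (measurableSet_le measurable_const (hf.add_const d))
  rw [integral_sub (tail_integrable μ) (tail_integrable ν), ← (layer μ).2, ← (layer ν).2] at key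
  have : ∫ s in Set.Ioc 0 (2 * d), t = t * (2 * d) := by
    simp [mul_comm, hd]
  linarith

lemma abs_integral_sub_le_of_tvDist_le {μ ν : Measure X} [IsProbabilityMeasure μ]
    [IsProbabilityMeasure ν] {t d : ℝ} (hd : 0 ≤ d) (h : tvDist μ ν ≤ t)
    {f : X → ℝ} (hf : Measurable f) (hfd : ∀ x, |f x| ≤ d) :
    |∫ x, f x ∂μ - ∫ x, f x ∂ν| ≤ t * (2 * d) := by
  have h' A (hA : MeasurableSet A) := (abs_sub_le_iff.1
    ((abs_measureReal_sub_le_tvDist μ ν hA).trans h))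
  exact abs_sub_le_iff.2
    ⟨integral_sub_le_of_measureReal_sub_le hd (fun A hA => (h' A hA).1) hf hfd,
    integral_sub_le_of_measureReal_sub_le hd (fun A hA => (h' A hA).2) hf hfd⟩

/-- If `μ` dominates `c • ν` with `ν` close to `π`, integrals of bounded `π`-centred functions
contract. -/
lemma abs_integral_le_of_smul_le {μ ν π : Measure X} [IsProbabilityMeasure μ]
    [IsProbabilityMeasure ν] [IsProbabilityMeasure π] {c t d : ℝ} (hc : 0 ≤ c)
    (hle : ENNReal.ofReal c • ν ≤ μ) (hd : 0 ≤ d) (h : tvDist ν π ≤ t)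
    {f : X → ℝ} (hf : Measurable f) (hfd : ∀ x, |f x| ≤ d) (hfπ : ∫ x, f x ∂π = 0) :
    |∫ x, f x ∂μ| ≤ (1 - c + 2 * c * t) * d := by
  have : IsFiniteMeasure (ENNReal.ofReal c • ν) := isFiniteMeasure_of_le μ hle
  have hdec := Measure.sub_add_cancel_of_le hle
  have hfin : IsFiniteMeasure (μ - ENNReal.ofReal c • ν) := inferInstance
  generalize μ - ENNReal.ofReal c • ν = ξ at hdec hfin
  have hi (m : Measure X) [IsFiniteMeasure m] : Integrable f m :=
    .of_bound hf.aestronglyMeasurable d (.of_forall hfd)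
  have hmass : ξ.real Set.univ = 1 - c := by
    have : (1 : ℝ) = ξ.real Set.univ + c := by
      rw [← probReal_univ (μ := μ), ← hdec, measureReal_add_apply, measureReal_ennreal_smul_apply,
        ENNReal.toReal_ofReal hc, probReal_univ (μ := ν), mul_one]
    linarith
  have hξf : |∫ x, f x ∂ξ| ≤ (1 - c) * d := by
    have := norm_integral_le_of_norm_le_const (μ := ξ) (f := f) (C := d)
      (.of_forall hfd)
    rwa [hmass, Real.norm_eq_abs, mul_comm] at this
  have hνf := abs_integral_sub_le_of_tvDist_le hd h hf hfd
  rw [hfπ, sub_zero] at hνf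
  rw [← hdec, integral_add_measure (hi ξ) (hi _), integral_smul_measure, ENNReal.toReal_ofReal hc,
    smul_eq_mul]
  calc |∫ x, f x ∂ξ + c * ∫ x, f x ∂ν| ≤ |∫ x, f x ∂ξ| + c * |∫ x, f x ∂ν| := by
        simpa [abs_mul, abs_of_nonneg hc] using abs_add_le (∫ x, f x ∂ξ) (c * ∫ x, f x ∂ν)
    _ ≤ (1 - c) * d + c * (t * (2 * d)) := by gcongr
    _ = _ := by ring

end TotalVariation

section KernelPowers

variable {X : Type*} [MeasurableSpace X]

instance isMarkovKernel_kpow (P : Kernel X X) [IsMarkovKernel P] (n : ℕ) :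
    IsMarkovKernel (kpow P n) := by
  induction n with
  | zero => exact inferInstanceAs (IsMarkovKernel Kernel.id)
  | succ n ih => exact inferInstanceAs (IsMarkovKernel (kpow P n ∘ₖ P))

lemma kpow_add (P : Kernel X X) (m n : ℕ) : kpow P (m + n) = kpow P m ∘ₖ kpow P n := by
  induction n with
  | zero => simp [kpow]
  | succ n ih => rw [← add_assoc, kpow, ih, kpow, Kernel.comp_assoc]

lemma bind_comp_of_invariant {π : Measure X} {P Q : Kernel X X} (hP : π.bind P = π)
    (hQ : π.bind Q = π) : π.bind (Q ∘ₖ P) = π := by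
  rw [← Measure.comp_assoc, hP, hQ]

lemma bind_id (π : Measure X) : π.bind (Kernel.id : Kernel X X) = π := Measure.id_comp

lemma bind_kpow {π : Measure X} {P : Kernel X X} (hP : π.bind P = π) (n : ℕ) :
    π.bind (kpow P n) = π := by
  induction n with
  | zero => exact bind_id π
  | succ n ih => exact bind_comp_of_invariant hP ih

lemma smul_kpow_le {P Q : Kernel X X} {w : ℝ≥0∞} (h : ∀ x, w • P x ≤ Q x) (n : ℕ) (x : X) :
    w ^ n • kpow P n x ≤ kpow Q n x := by
  induction n generalizing x with
  | zero => simp [kpow]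
  | succ n ih =>
    refine Measure.le_iff.2 fun s hs => ?_
    have hmeas := (kpow P n).measurable_coe hs
    rw [Measure.smul_apply, kpow, kpow, Kernel.comp_apply' _ _ _ hs, Kernel.comp_apply' _ _ _ hs]
    calc w ^ (n + 1) • ∫⁻ y, kpow P n y s ∂P x
        = ∫⁻ y, w ^ n * kpow P n y s ∂(w • P x) := by
          rw [lintegral_smul_measure, lintegral_const_mul _ hmeas, smul_eq_mul, smul_eq_mul,
            ← mul_assoc, pow_succ']
      _ ≤ ∫⁻ y, kpow Q n y s ∂Q x := lintegral_mono' (h x) fun y => by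
          simpa using Measure.le_iff.1 (ih y) s hs

lemma measureReal_bind (μ : Measure X) [IsFiniteMeasure μ] (P : Kernel X X) [IsMarkovKernel P]
    {A : Set X} (hA : MeasurableSet A) : (μ.bind P).real A = ∫ y, (P y).real A ∂μ := by
  rw [measureReal_def, Measure.bind_apply hA P.aemeasurable]
  exact (integral_toReal (P.measurable_coe hA).aemeasurable
    (.of_forall fun y => measure_lt_top _ _)).symm

lemma tvDist_kpow_add_le {P Q : Kernel X X} [IsMarkovKernel P] [IsMarkovKernel Q]
    {π : Measure X} [IsProbabilityMeasure π] (hQ : π.bind Q = π) {c t d : ℝ} (hc : 0 ≤ c)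
    {m n : ℕ} (hd : 0 ≤ d) (hle : ∀ x, ENNReal.ofReal c • kpow P m x ≤ kpow Q m x)
    (hP : ∀ x, tvDist (kpow P m x) π ≤ t) (hn : ∀ x, tvDist (kpow Q n x) π ≤ d) (x : X) :
    tvDist (kpow Q (n + m) x) π ≤ (1 - c + 2 * c * t) * d := by
  refine tvDist_le fun A hA => ?_
  have hmeas : Measurable fun y => (kpow Q n y).real A :=
    ((kpow Q n).measurable_coe hA).ennreal_toReal
  have hi (μ : Measure X) [IsProbabilityMeasure μ] :
      Integrable (fun y => (kpow Q n y).real A) μ :=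
    .of_bound hmeas.aestronglyMeasurable 1 (.of_forall fun y => by
      rw [Real.norm_eq_abs, abs_of_nonneg measureReal_nonneg]; exact measureReal_le_one)
  have hint (μ : Measure X) [IsProbabilityMeasure μ] :
      ∫ y, ((kpow Q n y).real A - π.real A) ∂μ = (μ.bind (kpow Q n)).real A - π.real A := by
    rw [integral_sub (hi μ) (integrable_const _), measureReal_bind μ _ hA]
    simp
  have := abs_integral_le_of_smul_le hc (hle x) hd (hP x) (hmeas.sub_const (π.real A))
    (fun y => (abs_measureReal_sub_le_tvDist _ _ hA).trans (hn y))
    (by rw [hint, bind_kpow hQ, sub_self])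
  rwa [hint, ← Kernel.comp_apply, ← kpow_add] at this

lemma uniformlyErgodic_of_contraction {Q : Kernel X X} [IsMarkovKernel Q]
    {π : Measure X} [IsProbabilityMeasure π] {b : ℝ} (hb : 0 < b) (hb1 : b < 1)
    {m : ℕ} (hm : 1 ≤ m)
    (h : ∀ n d, 0 ≤ d → (∀ x, tvDist (kpow Q n x) π ≤ d) →
      ∀ x, tvDist (kpow Q (n + m) x) π ≤ b * d) :
    UniformlyErgodic Q π := by
  have step (r k : ℕ) : ∀ x, tvDist (kpow Q (r + m * k) x) π ≤ b ^ k := by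
    induction k with
    | zero => exact fun x => by simpa using tvDist_le_one _ _
    | succ k ih =>
      intro x
      simpa [mul_add, add_assoc, pow_succ'] using h _ _ (by positivity) ih x
  have hm0 : (0 : ℝ) < m := by exact_mod_cast hm
  refine ⟨b⁻¹, b ^ (1 / m : ℝ), by positivity, by positivity,
    Real.rpow_lt_one hb.le hb1 (by positivity), fun n _ x => ?_⟩
  have hstep := step (n % m) (n / m) x
  rw [Nat.mod_add_div] at hstep
  refine hstep.trans ?_
  rw [← Real.rpow_mul_natCast hb.le, ← Real.rpow_neg_one, ← Real.rpow_add hb,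
    ← Real.rpow_natCast]
  refine Real.rpow_le_rpow_of_exponent_ge hb hb1.le ?_
  have : (n : ℝ) < m * ((n / m : ℕ) + 1) := by
    exact_mod_cast Nat.lt_mul_div_succ n hm
  have h' : (n : ℝ) / m < (n / m : ℕ) + 1 := by
    rw [div_lt_iff₀ hm0]; linarith
  have h'' : (1 / m : ℝ) * n = n / m := by ring
  linarith

/-- Uniform ergodicity passes from `P` to any `Q` with the same invariant law dominating a
positive multiple of `P`. -/
theorem UniformlyErgodic.of_smul_le {P Q : Kernel X X} [IsMarkovKernel P] [IsMarkovKernel Q]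
    {π : Measure X} [IsProbabilityMeasure π] (hP : UniformlyErgodic P π) (hQ : π.bind Q = π)
    {w : ℝ} (hw : 0 < w) (hw1 : w ≤ 1) (hle : ∀ x, ENNReal.ofReal w • P x ≤ Q x) :
    UniformlyErgodic Q π := by
  obtain ⟨M, ρ, hM, hρ, hρ1, hP⟩ := hP
  obtain ⟨m, hm, hm1⟩ : ∃ m : ℕ, M * ρ ^ m < 1 / 4 ∧ 1 ≤ m := by
    have := (tendsto_pow_atTop_nhds_zero_of_lt_one hρ hρ1).const_mul M
    rw [mul_zero] at this
    exact ((this.eventually_lt_const (by norm_num : (0 : ℝ) < 1 / 4)).and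
      (eventually_ge_atTop 1)).exists
  have hc : 0 < w ^ m := by positivity
  have hc1 : w ^ m ≤ 1 := pow_le_one₀ hw.le hw1
  refine uniformlyErgodic_of_contraction (b := 1 - w ^ m + 2 * w ^ m * (1 / 4))
    (by linarith) (by linarith) hm1 fun n d hd hn => ?_
  refine tvDist_kpow_add_le hQ hc.le hd (fun x => ?_) (fun x => (hP m hm1 x).trans hm.le) hn
  rw [ENNReal.ofReal_pow hw.le]
  exact smul_kpow_le hle m x

end KernelPowers

section Scans

variable {X : Type*} [MeasurableSpace X] {N : ℕ}

lemma seqComp_induction {p : Kernel X X → Prop} (hid : p Kernel.id)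
    (hcomp : ∀ κ η, p κ → p η → p (η ∘ₖ κ)) (l : List (Kernel X X)) (hl : ∀ κ ∈ l, p κ) :
    p (seqComp l) := by
  suffices ∀ acc, p acc → p (l.foldl (fun acc κ => κ ∘ₖ acc) acc) from this _ hid
  induction l with
  | nil => exact fun acc h => h
  | cons κ l ih =>
    intro acc h
    rw [List.foldl_cons]
    exact ih (fun η hη => hl η (by simp [hη])) _ (hcomp _ _ h (hl κ (by simp)))

lemma subsetComp_induction {p : Kernel X X → Prop} (hid : p Kernel.id)
    (hcomp : ∀ κ η, p κ → p η → p (η ∘ₖ κ)) {P : Fin N → Kernel X X} (hP : ∀ i, p (P i))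
    (S : Finset (Fin N)) : p (subsetComp P S) := by
  refine seqComp_induction hid hcomp _ fun κ hκ => ?_
  obtain ⟨i, -, rfl⟩ := List.mem_map.1 hκ
  exact hP i

lemma isMarkovKernel_subsetComp {P : Fin N → Kernel X X} (hP : ∀ i, IsMarkovKernel (P i))
    (S : Finset (Fin N)) : IsMarkovKernel (subsetComp P S) :=
  subsetComp_induction (p := fun κ => IsMarkovKernel κ) inferInstance
    (fun _ _ _ _ => inferInstance) hP S

lemma bind_subsetComp {P : Fin N → Kernel X X} {π : Measure X} (hinv : ∀ i, π.bind (P i) = π)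
    (S : Finset (Fin N)) : π.bind (subsetComp P S) = π :=
  subsetComp_induction (p := fun κ => π.bind κ = π) (bind_id π)
    (fun _ _ => bind_comp_of_invariant) hinv S

lemma one_sub_prod_one_sub_pos (hN : 1 ≤ N) {q : Fin N → ℝ} (hq : ∀ i, 0 < q i)
    (hq1 : ∀ i, q i ≤ 1) : 0 < 1 - ∏ i, (1 - q i) := by
  have : ∏ i, (1 - q i) < 1 := by
    rw [← Finset.mul_prod_erase _ _ (Finset.mem_univ (⟨0, hN⟩ : Fin N))]
    have h₁ : ∏ i ∈ Finset.univ.erase (⟨0, hN⟩ : Fin N), (1 - q i) ≤ 1 :=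
      Finset.prod_le_one (fun i _ => sub_nonneg.2 (hq1 i)) fun i _ => by linarith [hq i]
    have h₂ := hq ⟨0, hN⟩
    have h₃ := hq1 ⟨0, hN⟩
    nlinarith
  linarith

lemma selWeight_nonneg (hN : 1 ≤ N) {q : Fin N → ℝ} (hq : ∀ i, 0 < q i) (hq1 : ∀ i, q i ≤ 1)
    (S : Finset (Fin N)) : 0 ≤ selWeight q S :=
  div_nonneg (mul_nonneg (Finset.prod_nonneg fun i _ => (hq i).le)
    (Finset.prod_nonneg fun i _ => sub_nonneg.2 (hq1 i))) (one_sub_prod_one_sub_pos hN hq hq1).le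

lemma selWeight_univ_pos (hN : 1 ≤ N) {q : Fin N → ℝ} (hq : ∀ i, 0 < q i)
    (hq1 : ∀ i, q i ≤ 1) : 0 < selWeight q Finset.univ := by
  refine div_pos ?_ (one_sub_prod_one_sub_pos hN hq hq1)
  simpa using Finset.prod_pos fun i _ => hq i

lemma sum_selWeight (hN : 1 ≤ N) {q : Fin N → ℝ} (hq : ∀ i, 0 < q i) (hq1 : ∀ i, q i ≤ 1) :
    ∑ S ∈ Finset.univ.filter (fun S : Finset (Fin N) => S.Nonempty), selWeight q S = 1 := by
  have htotal : ∑ S : Finset (Fin N), (∏ i ∈ S, q i) * ∏ i ∈ Sᶜ, (1 - q i) = 1 := by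
    rw [← Fintype.prod_add]
    simp
  rw [← Finset.sum_filter_add_sum_filter_not _ (fun S : Finset (Fin N) => S.Nonempty)] at htotal
  have hempty : Finset.univ.filter (fun S : Finset (Fin N) => ¬ S.Nonempty) = {∅} := by
    ext S; simp
  rw [hempty, Finset.sum_singleton] at htotal
  simp only [selWeight]
  rw [← Finset.sum_div, div_eq_one_iff_eq (one_sub_prod_one_sub_pos hN hq hq1).ne']
  simp only [Finset.prod_empty, Finset.compl_empty, one_mul] at htotal
  linarith

lemma mrsKernel_apply (P : Fin N → Kernel X X) (q : Fin N → ℝ) (x : X) (s : Set X) :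
    mrsKernel P q x s = ∑ S ∈ Finset.univ.filter (fun S : Finset (Fin N) => S.Nonempty),
      ENNReal.ofReal (selWeight q S) * subsetComp P S x s := by
  rw [mrsKernel, Kernel.finsetSum_apply']
  rfl

lemma sum_ofReal_selWeight (hN : 1 ≤ N) {q : Fin N → ℝ} (hq : ∀ i, 0 < q i)
    (hq1 : ∀ i, q i ≤ 1) :
    ∑ S ∈ Finset.univ.filter (fun S : Finset (Fin N) => S.Nonempty),
      ENNReal.ofReal (selWeight q S) = 1 := by
  rw [← ENNReal.ofReal_sum_of_nonneg fun S _ => selWeight_nonneg hN hq hq1 S,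
    sum_selWeight hN hq hq1, ENNReal.ofReal_one]

lemma isMarkovKernel_mrsKernel (hN : 1 ≤ N) {P : Fin N → Kernel X X}
    (hP : ∀ i, IsMarkovKernel (P i)) {q : Fin N → ℝ} (hq : ∀ i, 0 < q i) (hq1 : ∀ i, q i ≤ 1) :
    IsMarkovKernel (mrsKernel P q) := by
  refine ⟨fun x => ⟨?_⟩⟩
  have := isMarkovKernel_subsetComp hP
  simp [mrsKernel_apply, sum_ofReal_selWeight hN hq hq1]

lemma bind_mrsKernel (hN : 1 ≤ N) {P : Fin N → Kernel X X} {π : Measure X}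
    (hinv : ∀ i, π.bind (P i) = π) {q : Fin N → ℝ} (hq : ∀ i, 0 < q i) (hq1 : ∀ i, q i ≤ 1) :
    π.bind (mrsKernel P q) = π := by
  ext s hs
  rw [Measure.bind_apply hs (Kernel.aemeasurable _)]
  simp_rw [mrsKernel_apply]
  rw [lintegral_finsetSum _ fun S _ => ((subsetComp P S).measurable_coe hs).const_mul _]
  calc _ = ∑ S ∈ Finset.univ.filter (fun S : Finset (Fin N) => S.Nonempty),
        ENNReal.ofReal (selWeight q S) * π s := by
        refine Finset.sum_congr rfl fun S _ => ?_
        rw [lintegral_const_mul _ ((subsetComp P S).measurable_coe hs),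
          ← Measure.bind_apply hs (Kernel.aemeasurable _), bind_subsetComp hinv]
    _ = π s := by rw [← Finset.sum_mul, sum_ofReal_selWeight hN hq hq1, one_mul]

lemma smul_gsKernel_le_mrsKernel (hN : 1 ≤ N) (P : Fin N → Kernel X X) (q : Fin N → ℝ) (x : X) :
    ENNReal.ofReal (selWeight q Finset.univ) • gsKernel P x ≤ mrsKernel P q x := by
  refine Measure.le_iff.2 fun s _ => ?_
  rw [mrsKernel_apply, Measure.smul_apply, smul_eq_mul]
  exact Finset.single_le_sum
    (f := fun S => ENNReal.ofReal (selWeight q S) * subsetComp P S x s)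
    (fun _ _ => zero_le) (Finset.mem_filter.2 ⟨Finset.mem_univ _, ⟨⟨0, hN⟩, Finset.mem_univ _⟩⟩)

end Scans

/-- Proposition 3.1. If each `P_i` leaves `π` invariant and the
systematic-scan kernel `P_GS = P_1 ⋯ P_N` is uniformly ergodic with invariant
distribution `π`, then for every `ε > 0` and every `q ∈ [ε,1]^N` the multiple
random-scan kernel `P_q` is uniformly ergodic with invariant distribution `π`. -/
theorem mrs_uniformly_ergodic
    {X : Type*} [MeasurableSpace X] {N : ℕ} (hN : 1 ≤ N)
    (P : Fin N → Kernel X X) (hP : ∀ i, IsMarkovKernel (P i))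
    (π : Measure X) [IsProbabilityMeasure π]
    (hinv : ∀ i, π.bind (P i) = π)
    (hGSinv : π.bind (gsKernel P) = π)
    (hGS : UniformlyErgodic (gsKernel P) π) :
    ∀ ε : ℝ, 0 < ε → ∀ q : Fin N → ℝ, (∀ i, ε ≤ q i ∧ q i ≤ 1) →
      π.bind (mrsKernel P q) = π ∧ UniformlyErgodic (mrsKernel P q) π := by
  intro ε hε q hq
  have hq0 i : 0 < q i := hε.trans_le (hq i).1
  have hq1 i : q i ≤ 1 := (hq i).2
  have : IsMarkovKernel (gsKernel P) := isMarkovKernel_subsetComp hP _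
  have := isMarkovKernel_mrsKernel hN hP hq0 hq1
  have hbind := bind_mrsKernel hN hinv hq0 hq1
  refine ⟨hbind, hGS.of_smul_le hbind (selWeight_univ_pos hN hq0 hq1) ?_
    (smul_gsKernel_le_mrsKernel hN P q)⟩
  rw [← sum_selWeight hN hq0 hq1]
  exact Finset.single_le_sum (fun S _ => selWeight_nonneg hN hq0 hq1 S)
    (Finset.mem_filter.2 ⟨Finset.mem_univ _, ⟨⟨0, hN⟩, Finset.mem_univ _⟩⟩)
end

section
/- Let P_1, …, P_N be Markov kernels on a measurable space (X, ℬ) and suppose there exist an integer m ≥ 1, δ ∈ (0,1], and a probability measure ν such that P_GS^m(x,A) ≥ δ ν(A) for all x ∈ X and A ∈ ℬ, where P_GS = P_1 P_2 ⋯ P_N. Then for every ε > 0 and every q ∈ [ε,1]^N, the multiple random-scan kernel satisfies the simultaneous minorization P_q^m(x,A) ≥ ε^{Nm} δ ν(A) for all x ∈ X and A ∈ ℬ, with minorization constant independent of q ∈ [ε,1]^N. -/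
open MeasureTheory ProbabilityTheory Filter
open scoped ENNReal

/-- The weight of the full scan is at least `ε ^ N` when every selection probability is in
`[ε, 1]`. -/
theorem pow_le_selWeight_univ {N : ℕ} (hN : 1 ≤ N) {ε : ℝ} (hε : 0 < ε) {q : Fin N → ℝ}
    (hq : ∀ i, ε ≤ q i ∧ q i ≤ 1) : ε ^ N ≤ selWeight q Finset.univ := by
  have hε1 : ε ≤ 1 := (hq ⟨0, hN⟩).1.trans (hq ⟨0, hN⟩).2
  have hprod : ε ^ N ≤ ∏ i, q i := by
    simpa using Finset.prod_le_prod (s := Finset.univ) (f := fun _ : Fin N => ε)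
      (fun _ _ => hε.le) (fun i _ => (hq i).1)
  have hnonneg : 0 ≤ ∏ i, (1 - q i) :=
    Finset.prod_nonneg fun i _ => sub_nonneg.2 (hq i).2
  have hle : ∏ i, (1 - q i) ≤ (1 - ε) ^ N := by
    simpa using Finset.prod_le_prod (s := Finset.univ) (g := fun _ : Fin N => 1 - ε)
      (fun i _ => sub_nonneg.2 (hq i).2) (fun i _ => sub_le_sub_left (hq i).1 1)
  have hlt : (1 - ε) ^ N < 1 :=
    pow_lt_one₀ (sub_nonneg.2 hε1) (sub_lt_self 1 hε) (by lia)
  have hsel : selWeight q Finset.univ = (∏ i, q i) / (1 - ∏ i, (1 - q i)) := by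
    simp [selWeight]
  rw [hsel, le_div_iff₀ (by linarith)]
  nlinarith [pow_pos hε N]

/-- A mixture of kernels dominates each of its components. -/
theorem selWeight_smul_le_mrsKernel {X : Type*} [MeasurableSpace X] {N : ℕ}
    (P : Fin N → Kernel X X) (q : Fin N → ℝ) {S : Finset (Fin N)} (hS : S.Nonempty) (x : X) :
    ENNReal.ofReal (selWeight q S) • subsetComp P S x ≤ mrsKernel P q x := by
  refine Measure.le_iff.2 fun A _ => ?_
  rw [mrsKernel, Kernel.finsetSum_apply']
  exact Finset.single_le_sum
    (f := fun S => kSMul (ENNReal.ofReal (selWeight q S)) (subsetComp P S) x A)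
    (fun _ _ => zero_le) (by simpa using hS)

/-- Domination of one kernel by another up to a constant passes to powers. -/
theorem pow_mul_kpow_le {X : Type*} [MeasurableSpace X] {Q P : Kernel X X} {c : ℝ≥0∞}
    (h : ∀ x, c • Q x ≤ P x) (n : ℕ) (x : X) {A : Set X} (hA : MeasurableSet A) :
    c ^ n * kpow Q n x A ≤ kpow P n x A := by
  induction n generalizing x with
  | zero => simp [kpow]
  | succ n ih =>
    simp only [kpow, Kernel.comp_apply' _ _ _ hA]
    calc c ^ (n + 1) * ∫⁻ y, kpow Q n y A ∂Q x
        = ∫⁻ y, c ^ n * kpow Q n y A ∂(c • Q x) := by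
          rw [lintegral_smul_measure, lintegral_const_mul _ (Kernel.measurable_coe _ hA),
            smul_eq_mul, pow_succ']
          ring
      _ ≤ ∫⁻ y, kpow P n y A ∂P x := lintegral_mono' (h x) ih

/-- If `P_GS^m(x,A) ≥ δ ν(A)` for all `x` and measurable `A`, then for
every `ε > 0` and `q ∈ [ε,1]^N` the multiple random-scan kernel satisfies the
simultaneous minorization `P_q^m(x,A) ≥ ε^{Nm} δ ν(A)`. -/
theorem mrs_simultaneous_minorization
    {X : Type*} [MeasurableSpace X] {N : ℕ} (hN : 1 ≤ N)
    (P : Fin N → Kernel X X) (hP : ∀ i, IsMarkovKernel (P i))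
    (m : ℕ) (hm : 1 ≤ m) (δ : ℝ) (hδ0 : 0 < δ) (hδ1 : δ ≤ 1)
    (ν : Measure X) [IsProbabilityMeasure ν]
    (hminor : ∀ x : X, ∀ A : Set X, MeasurableSet A →
      ENNReal.ofReal δ * ν A ≤ kpow (gsKernel P) m x A) :
    ∀ ε : ℝ, 0 < ε → ∀ q : Fin N → ℝ, (∀ i, ε ≤ q i ∧ q i ≤ 1) →
      ∀ x : X, ∀ A : Set X, MeasurableSet A →
        ENNReal.ofReal (ε ^ (N * m) * δ) * ν A ≤ kpow (mrsKernel P q) m x A := by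
  intro ε hε q hq x A hA
  have hdom : ∀ y, ENNReal.ofReal (ε ^ N) • gsKernel P y ≤ mrsKernel P q y := fun y =>
    (Measure.le_iff.2 fun B _ => mul_le_mul_left
      (ENNReal.ofReal_le_ofReal (pow_le_selWeight_univ hN hε hq)) _).trans
      (selWeight_smul_le_mrsKernel P q ⟨⟨0, hN⟩, Finset.mem_univ _⟩ y)
  calc ENNReal.ofReal (ε ^ (N * m) * δ) * ν A
      = ENNReal.ofReal (ε ^ N) ^ m * (ENNReal.ofReal δ * ν A) := by
        rw [ENNReal.ofReal_mul (by positivity), pow_mul, ENNReal.ofReal_pow (by positivity),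
          mul_assoc]
    _ ≤ ENNReal.ofReal (ε ^ N) ^ m * kpow (gsKernel P) m x A := by
        gcongr
        exact hminor x A hA
    _ ≤ kpow (mrsKernel P q) m x A := pow_mul_kpow_le hdom m x hA
end

section
/- Let P be a Markov kernel on a measurable space (X, ℬ), δ ∈ (0,1], and ν a probability measure on (X, ℬ) such that P(x,A) ≥ δ ν(A) for all x ∈ X and A ∈ ℬ (a one-step Doeblin minorization). Then for all probability measures μ and μ' on (X, ℬ): ‖μP − μ'P‖_TV ≤ (1 − δ) ‖μ − μ'‖_TV. -/
open MeasureTheory ProbabilityTheory Filter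
open scoped ENNReal

lemma abs_sub_le_tvDist {X : Type*} [MeasurableSpace X] (μ ν : Measure X)
    [IsProbabilityMeasure μ] [IsProbabilityMeasure ν] {A : Set X} (hA : MeasurableSet A) :
    |(μ A).toReal - (ν A).toReal| ≤ tvDist μ ν := by
  refine le_ciSup (f := fun A : {s : Set X // MeasurableSet s} =>
    |(μ A.1).toReal - (ν A.1).toReal|) ⟨1, ?_⟩ ⟨A, hA⟩
  rintro _ ⟨B, rfl⟩
  have h₁ : (μ B.1).toReal ≤ 1 := measureReal_le_one
  have h₂ : (ν B.1).toReal ≤ 1 := measureReal_le_one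
  have h₃ : 0 ≤ (μ B.1).toReal := ENNReal.toReal_nonneg
  have h₄ : 0 ≤ (ν B.1).toReal := ENNReal.toReal_nonneg
  exact abs_le.2 ⟨by linarith, by linarith⟩

lemma tvDist_comm {X : Type*} [MeasurableSpace X] (μ ν : Measure X) :
    tvDist μ ν = tvDist ν μ := by
  simp only [tvDist, abs_sub_comm]

/-- The integrals of a function with values in `[a, b]` against two probability measures differ
by at most `b - a` times their total variation distance. -/
lemma integral_sub_integral_le_tvDist {X : Type*} [MeasurableSpace X] (μ ν : Measure X)
    [IsProbabilityMeasure μ] [IsProbabilityMeasure ν] {f : X → ℝ} (hf : Measurable f)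
    {a b : ℝ} (hab : a ≤ b) (ha : ∀ x, a ≤ f x) (hb : ∀ x, f x ≤ b) :
    ∫ x, f x ∂μ - ∫ x, f x ∂ν ≤ (b - a) * tvDist μ ν := by
  obtain ⟨s, hs⟩ := exists_isHahnDecomposition ν μ
  have hint : ∀ (ρ : Measure X) [IsFiniteMeasure ρ], Integrable f ρ := fun ρ _ =>
    Integrable.of_mem_Icc a b hf.aemeasurable (ae_of_all _ fun x => ⟨ha x, hb x⟩)
  have h₁ : ∫ x in s, (b - f x) ∂ν ≤ ∫ x in s, (b - f x) ∂μ :=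
    integral_mono_measure hs.le_on (ae_of_all _ fun x => sub_nonneg.2 (hb x))
      ((integrable_const b).sub (hint _))
  have h₂ : ∫ x in sᶜ, (f x - a) ∂μ ≤ ∫ x in sᶜ, (f x - a) ∂ν :=
    integral_mono_measure hs.ge_on_compl (ae_of_all _ fun x => sub_nonneg.2 (ha x))
      ((hint _).sub (integrable_const a))
  rw [integral_sub (integrable_const b) (hint _), integral_sub (integrable_const b) (hint _)] at h₁
  rw [integral_sub (hint _) (integrable_const a), integral_sub (hint _) (integrable_const a)] at h₂
  simp only [setIntegral_const, smul_eq_mul, probReal_compl_eq_one_sub hs.measurableSet] at h₁ h₂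
  rw [← integral_add_compl hs.measurableSet (hint μ), ← integral_add_compl hs.measurableSet (hint ν)]
  have h₃ : μ.real s - ν.real s ≤ tvDist μ ν :=
    (le_abs_self _).trans (abs_sub_le_tvDist μ ν hs.measurableSet)
  have h₄ := mul_le_mul_of_nonneg_left h₃ (sub_nonneg.2 hab)
  linarith

/-- one-step Doeblin contraction. If `P(x,A) ≥ δ ν(A)` for all `x`
and measurable `A`, then for all probability measures `μ, μ'`:
`‖μP − μ'P‖_TV ≤ (1 − δ) ‖μ − μ'‖_TV`. -/
theorem doeblin_one_step_contraction
    {X : Type*} [MeasurableSpace X]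
    (P : Kernel X X) (hP : IsMarkovKernel P)
    (δ : ℝ) (hδ0 : 0 < δ) (hδ1 : δ ≤ 1)
    (ν : Measure X) [IsProbabilityMeasure ν]
    (hminor : ∀ x : X, ∀ A : Set X, MeasurableSet A →
      ENNReal.ofReal δ * ν A ≤ P x A)
    (μ μ' : Measure X) [IsProbabilityMeasure μ] [IsProbabilityMeasure μ'] :
    tvDist (μ.bind P) (μ'.bind P) ≤ (1 - δ) * tvDist μ μ' := by
  have hf : ∀ A : Set X, MeasurableSet A → Measurable fun x => (P x).real A := fun A hA =>
    (P.measurable_coe hA).ennreal_toReal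
  have hlow : ∀ A : Set X, MeasurableSet A → ∀ x, δ * ν.real A ≤ (P x).real A := by
    intro A hA x
    have h := ENNReal.toReal_mono (measure_ne_top _ _) (hminor x A hA)
    rwa [ENNReal.toReal_mul, ENNReal.toReal_ofReal hδ0.le] at h
  have hup : ∀ A : Set X, MeasurableSet A → ∀ x, (P x).real A ≤ δ * ν.real A + (1 - δ) := by
    intro A hA x
    have h := hlow Aᶜ hA.compl x
    rw [probReal_compl_eq_one_sub hA, probReal_compl_eq_one_sub hA] at h
    linarith
  have hbind : ∀ (ρ : Measure X) [IsProbabilityMeasure ρ] (A : Set X), MeasurableSet A →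
      (ρ.bind P A).toReal = ∫ x, (P x).real A ∂ρ := by
    intro ρ _ A hA
    rw [Measure.bind_apply hA P.aemeasurable]
    exact (integral_toReal (P.measurable_coe hA).aemeasurable
      (ae_of_all _ fun x => measure_lt_top _ _)).symm
  have hdiff : ∀ (ρ ρ' : Measure X) [IsProbabilityMeasure ρ] [IsProbabilityMeasure ρ']
      (A : Set X), MeasurableSet A →
      (ρ.bind P A).toReal - (ρ'.bind P A).toReal ≤ (1 - δ) * tvDist ρ ρ' := by
    intro ρ ρ' _ _ A hA
    rw [hbind ρ A hA, hbind ρ' A hA]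
    simpa using integral_sub_integral_le_tvDist ρ ρ' (hf A hA) (by linarith)
      (hlow A hA) (hup A hA)
  have : Nonempty {s : Set X // MeasurableSet s} := ⟨⟨∅, .empty⟩⟩
  refine ciSup_le fun A => abs_sub_le_iff.2 ⟨hdiff μ μ' A.1 A.2, ?_⟩
  rw [tvDist_comm]
  exact hdiff μ' μ A.1 A.2
end
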